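/- For every A ∈ GL(n,k), all 1 ≤ i ≤ p and all 1 ≤ j ≤ q−1, one has ker χ_ij(A) = dom χ_{i(j+1)}(A) (as subspaces of V_i). (First chain condition of Proposition 1(b).) -/

import Mathlib

namespace Neretin

open scoped BigOperators

variable {k : Type*} [Field k]

/-- Offset of the `i`-th block of the partition `α`. -/
def off {p : ℕ} (α : Fin p → ℕ) (i : Fin p) : ℕ := ∑ i' ∈ Finset.Iio i, α i'

theorem coord_lt {p n : ℕ} {α : Fin p → ℕ} (hα : ∑ i, α i = n) (i : Fin p)
    (t : Fin (α i)) : off α i + (t : ℕ) < n := by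
  have h1 : off α i + α i ≤ n := by
    rw [← hα]
    have h2 : insert i (Finset.Iio i) = Finset.Iic i := Finset.Iio_insert i
    have h3 : off α i + α i = ∑ i' ∈ Finset.Iic i, α i' := by
      rw [← h2, Finset.sum_insert (by simp)]
      unfold off
      omega
    rw [h3]
    exact Finset.sum_le_sum_of_subset (Finset.subset_univ _)
  have h4 := t.isLt
  omega

/-- The coordinate of `k^n` corresponding to the `t`-th coordinate of the `i`-th block. -/
def coord {p n : ℕ} {α : Fin p → ℕ} (hα : ∑ i, α i = n) (i : Fin p) (t : Fin (α i)) : Fin n :=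
  ⟨off α i + (t : ℕ), coord_lt hα i t⟩

/-- Subspace of vectors vanishing at all coordinates satisfying `P`. -/
def vanishOn {ι : Type*} (P : ι → Prop) : Submodule k (ι → k) :=
  ⨅ r ∈ {r : ι | P r}, LinearMap.ker (LinearMap.proj (R := k) (φ := fun _ : ι => k) r)

/-- The linear relation `χ_ij(A) : V_i ⇉ W_j`. -/
def chi {p q n : ℕ} (α : Fin p → ℕ) (β : Fin q → ℕ) (hα : ∑ i, α i = n) (hβ : ∑ j, β j = n)
    (A : Matrix (Fin n) (Fin n) k) (i : Fin p) (j : Fin q) :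
    Submodule k ((Fin (α i) → k) × (Fin (β j) → k)) :=
  Submodule.map
    ((LinearMap.funLeft k k (coord hα i)).prod
      ((LinearMap.funLeft k k (coord hβ j)).comp (Matrix.mulVecLin A)))
    (vanishOn (fun r : Fin n => off α i + α i ≤ (r : ℕ)) ⊓
      Submodule.comap (Matrix.mulVecLin A) (vanishOn fun r : Fin n => (r : ℕ) < off β j))

section Rel

variable {X Y : Type*} [AddCommGroup X] [Module k X] [AddCommGroup Y] [Module k Y]

/-- Kernel of a linear relation. -/
def rker (L : Submodule k (X × Y)) : Submodule k X := Submodule.comap (LinearMap.inl k X Y) L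

/-- Domain of a linear relation. -/
def rdom (L : Submodule k (X × Y)) : Submodule k X := Submodule.map (LinearMap.fst k X Y) L

/-- Image of a linear relation. -/
def rim (L : Submodule k (X × Y)) : Submodule k Y := Submodule.map (LinearMap.snd k X Y) L

/-- Indefiniteness of a linear relation. -/
def rindef (L : Submodule k (X × Y)) : Submodule k Y := Submodule.comap (LinearMap.inr k X Y) L

end Rel

/-- `blockLT α a b`: coordinate `a` lies in a strictly earlier block than `b`. -/
def blockLT {p : ℕ} (α : Fin p → ℕ) (a b : ℕ) : Prop :=
  ∃ i : Fin p, off α i ≤ b ∧ a < off α i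

/-- `sameBlock α a b` : coordinates `a`, `b` lie in the same block. -/
def sameBlock {p : ℕ} (α : Fin p → ℕ) (a b : ℕ) : Prop :=
  ∀ i : Fin p, off α i ≤ a ↔ off α i ≤ b

/-- Block upper triangular matrices (the group `P_+`). -/
def IsPPlus {n p : ℕ} (α : Fin p → ℕ) (g : Matrix (Fin n) (Fin n) k) : Prop :=
  ∀ r s : Fin n, blockLT α (s : ℕ) (r : ℕ) → g r s = 0

/-- Block lower triangular matrices (the group `P_-`). -/
def IsPMinus {n p : ℕ} (α : Fin p → ℕ) (g : Matrix (Fin n) (Fin n) k) : Prop :=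
  ∀ r s : Fin n, blockLT α (r : ℕ) (s : ℕ) → g r s = 0

/-- Block strictly upper triangular matrices (the group `T_+`). -/
def IsTPlus {n p : ℕ} (α : Fin p → ℕ) (g : Matrix (Fin n) (Fin n) k) : Prop :=
  IsPPlus α g ∧ ∀ r s : Fin n, sameBlock α (r : ℕ) (s : ℕ) → g r s = if r = s then 1 else 0

/-- Block strictly lower triangular matrices (the group `T_-`). -/
def IsTMinus {n p : ℕ} (α : Fin p → ℕ) (g : Matrix (Fin n) (Fin n) k) : Prop :=
  IsPMinus α g ∧ ∀ r s : Fin n, sameBlock α (r : ℕ) (s : ℕ) → g r s = if r = s then 1 else 0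

/-- Bi-hinges. -/
def IsBiHinge {p q : ℕ} (α : Fin p → ℕ) (β : Fin q → ℕ)
    (ξ : (i : Fin p) → (j : Fin q) → Submodule k ((Fin (α i) → k) × (Fin (β j) → k))) : Prop :=
  (∀ (i : Fin p) (j j' : Fin q), (j' : ℕ) = (j : ℕ) + 1 → rker (ξ i j) = rdom (ξ i j')) ∧
  (∀ (i i' : Fin p) (j : Fin q), (i' : ℕ) = (i : ℕ) + 1 → rim (ξ i j) = rindef (ξ i' j)) ∧
  (∀ (i : Fin p) (j : Fin q), (i : ℕ) = 0 → rindef (ξ i j) = ⊥) ∧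
  (∀ (i : Fin p) (j : Fin q), (i : ℕ) + 1 = p → rim (ξ i j) = ⊤) ∧
  (∀ (i : Fin p) (j : Fin q), (j : ℕ) + 1 = q → rker (ξ i j) = ⊥) ∧
  (∀ (i : Fin p) (j : Fin q), (j : ℕ) = 0 → rdom (ξ i j) = ⊤)

/-- 0-1 matrices with exactly one unit in each row and each column. -/
def IsPermMatrix {n : ℕ} (M : Matrix (Fin n) (Fin n) k) : Prop :=
  ∃ σ : Equiv.Perm (Fin n), ∀ r s, M r s = if r = σ s then 1 else 0

/-- Offset of the sub-block `V_i^j` inside `V_i`. -/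
def offA {p q : ℕ} (a : Fin p → Fin q → ℕ) (i : Fin p) (j : Fin q) : ℕ :=
  ∑ j' ∈ Finset.Iio j, a i j'

/-- Offset of the sub-block `W_j^i` inside `W_j`. -/
def offB {p q : ℕ} (a : Fin p → Fin q → ℕ) (i : Fin p) (j : Fin q) : ℕ :=
  ∑ i' ∈ Finset.Iio i, a i' j

open Classical in
/-- The standard 0-1 matrix determined by the dimension data `a`. -/
noncomputable def stdMatrix {p q : ℕ} (n : ℕ) (α : Fin p → ℕ) (β : Fin q → ℕ)
    (a : Fin p → Fin q → ℕ) : Matrix (Fin n) (Fin n) k :=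
  Matrix.of fun r s : Fin n =>
    if ∃ (i : Fin p) (j : Fin q) (t : ℕ), t < a i j ∧
        (s : ℕ) = off α i + offA a i j + t ∧ (r : ℕ) = off β j + offB a i j + t
      then (1 : k) else 0

/-- The standard bi-hinge determined by the dimension data `a`. -/
def stdHinge {p q : ℕ} (α : Fin p → ℕ) (β : Fin q → ℕ) (a : Fin p → Fin q → ℕ)
    (i : Fin p) (j : Fin q) : Submodule k ((Fin (α i) → k) × (Fin (β j) → k)) where
  carrier := {z | (∀ u : Fin (α i), (u : ℕ) < offA a i j → z.1 u = 0) ∧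
    (∀ v : Fin (β j), offB a i j + a i j ≤ (v : ℕ) → z.2 v = 0) ∧
    ∀ (u : Fin (α i)) (v : Fin (β j)) (t : ℕ), t < a i j →
      (u : ℕ) = offA a i j + t → (v : ℕ) = offB a i j + t → z.1 u = z.2 v}
  add_mem' := by
    rintro x y ⟨hx1, hx2, hx3⟩ ⟨hy1, hy2, hy3⟩
    refine ⟨fun u hu => ?_, fun v hv => ?_, fun u v t ht hu hv => ?_⟩
    · show x.1 u + y.1 u = 0
      rw [hx1 u hu, hy1 u hu, add_zero]
    · show x.2 v + y.2 v = 0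
      rw [hx2 v hv, hy2 v hv, add_zero]
    · show x.1 u + y.1 u = x.2 v + y.2 v
      rw [hx3 u v t ht hu hv, hy3 u v t ht hu hv]
  zero_mem' := ⟨fun _ _ => rfl, fun _ _ => rfl, fun _ _ _ _ _ _ => rfl⟩
  smul_mem' := by
    rintro c x ⟨hx1, hx2, hx3⟩
    refine ⟨fun u hu => ?_, fun v hv => ?_, fun u v t ht hu hv => ?_⟩
    · show c * x.1 u = 0
      rw [hx1 u hu, mul_zero]
    · show c * x.2 v = 0
      rw [hx2 v hv, mul_zero]
    · show c * x.1 u = c * x.2 v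
      rw [hx3 u v t ht hu hv]

theorem off_succ {p : ℕ} (α : Fin p → ℕ) {i i' : Fin p} (h : (i' : ℕ) = (i : ℕ) + 1) :
    off α i' = off α i + α i := by
  have h1 : Finset.Iio i' = insert i (Finset.Iio i) := by
    ext a
    simp only [Finset.mem_Iio, Finset.mem_insert, Fin.lt_def, Fin.ext_iff]
    omega
  unfold off
  rw [h1, Finset.sum_insert (by simp), add_comm]

theorem mem_vanishOn {ι : Type*} {P : ι → Prop} {x : ι → k} :
    x ∈ vanishOn P ↔ ∀ r, P r → x r = 0 := by
  simp [vanishOn]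

theorem mem_chi {p q n : ℕ} {α : Fin p → ℕ} {β : Fin q → ℕ} {hα : ∑ i, α i = n}
    {hβ : ∑ j, β j = n} {A : Matrix (Fin n) (Fin n) k} {i : Fin p} {j : Fin q}
    {z : (Fin (α i) → k) × (Fin (β j) → k)} :
    z ∈ chi α β hα hβ A i j ↔ ∃ x : Fin n → k,
      (∀ r : Fin n, off α i + α i ≤ (r : ℕ) → x r = 0) ∧
      (∀ r : Fin n, (r : ℕ) < off β j → A.mulVec x r = 0) ∧
      x ∘ coord hα i = z.1 ∧ A.mulVec x ∘ coord hβ j = z.2 := by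
  simp only [chi, Submodule.mem_map, Submodule.mem_inf, Submodule.mem_comap, mem_vanishOn,
    Matrix.mulVecLin_apply, and_assoc, Prod.ext_iff]
  rfl

/-- A vector vanishes before block `j'` iff it vanishes before the preceding block `j` and its
`j`-th component is zero. -/
theorem vanish_lt_off_succ_iff {q n : ℕ} {β : Fin q → ℕ} (hβ : ∑ j, β j = n) {j j' : Fin q}
    (hj : (j' : ℕ) = (j : ℕ) + 1) (y : Fin n → k) :
    (∀ r : Fin n, (r : ℕ) < off β j' → y r = 0) ↔
      (∀ r : Fin n, (r : ℕ) < off β j → y r = 0) ∧ y ∘ coord hβ j = 0 := by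
  rw [off_succ β hj]
  refine ⟨fun h => ⟨fun r hr => h r (by omega), funext fun t => h _ ?_⟩, fun ⟨h₁, h₂⟩ r hr => ?_⟩
  · exact Nat.add_lt_add_left t.isLt _
  · by_cases hlt : (r : ℕ) < off β j
    · exact h₁ r hlt
    · have hr' : coord hβ j ⟨(r : ℕ) - off β j, by omega⟩ = r := by
        apply Fin.ext
        simp only [coord]
        omega
      rw [← hr']
      exact congrFun h₂ _

theorem statement1 (p q n : ℕ) (hp : 0 < p) (hq : 0 < q)
    (α : Fin p → ℕ) (β : Fin q → ℕ)
    (hαpos : ∀ i, 0 < α i) (hβpos : ∀ j, 0 < β j)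
    (hα : ∑ i, α i = n) (hβ : ∑ j, β j = n)
    (A : GL (Fin n) k) (i : Fin p) (j j' : Fin q) (hj : (j' : ℕ) = (j : ℕ) + 1) :
    rker (chi α β hα hβ A.val i j) = rdom (chi α β hα hβ A.val i j') := by
  ext ξ
  simp only [rker, rdom, Submodule.mem_comap, Submodule.mem_map, Prod.exists, LinearMap.fst_apply,
    LinearMap.inl_apply, mem_chi, exists_and_right, exists_eq_right,
    vanish_lt_off_succ_iff hβ hj]
  constructor
  · rintro ⟨x, hx, hlt, hξ, hzero⟩
    exact ⟨_, x, hx, ⟨hlt, hzero⟩, hξ, rfl⟩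
  · rintro ⟨_, x, hx, ⟨hlt, hzero⟩, hξ, _⟩
    exact ⟨x, hx, hlt, hξ, hzero⟩

end Neretin
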